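/- arXiv:1512.07267 — 8 statements merged into one kernel-verified Lean document; each statement's English description precedes it below -/
import Mathlib

section
/- Let n ≥ 2 and y be integers with 1 ≤ y ≤ n−1. Then there exist constants c1, c2 > 0 depending only on n and y such that for all r > 0 and all p ∈ (0,1), writing q = 1−p: c1·r·p·q/(1+r)^(n−1) ≤ B(y + r·p, n−y + r·q)/B(r·p, r·q) ≤ c2·r·p·q/(1+r). (In fact one may take c2 = 1.) -/
open MeasureTheory Real Filter Finset

/-- The Beta function `B(a,b) = ∫₀¹ v^(a-1) (1-v)^(b-1) dv`. -/
noncomputable def betaFn (a b : ℝ) : ℝ :=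
  ∫ v in (0:ℝ)..1, v ^ (a - 1) * (1 - v) ^ (b - 1)

/-- The standard logistic function `σ(t) = exp t / (1 + exp t)`. -/
noncomputable def logistic (t : ℝ) : ℝ := Real.exp t / (1 + Real.exp t)

/-- Expected random effect `p_j^E(β) = σ(x_jᵀ β)`. -/
noncomputable def pE {k m : ℕ} (x : Fin k → Fin m → ℝ) (j : Fin k) (β : Fin m → ℝ) : ℝ :=
  logistic (∑ i, x j i * β i)

/-- The Beta-Binomial likelihood
`L(r,β) = ∏ⱼ C(nⱼ,yⱼ) B(yⱼ + r pⱼᴱ, nⱼ - yⱼ + r qⱼᴱ) / B(r pⱼᴱ, r qⱼᴱ)`. -/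
noncomputable def bbL {k m : ℕ} (x : Fin k → Fin m → ℝ) (n y : Fin k → ℕ)
    (r : ℝ) (β : Fin m → ℝ) : ℝ :=
  ∏ j : Fin k,
    ((n j).choose (y j) : ℝ) *
      betaFn ((y j : ℝ) + r * pE x j β) (((n j : ℝ) - (y j : ℝ)) + r * (1 - pE x j β)) /
      betaFn (r * pE x j β) (r * (1 - pE x j β))

theorem betaFn_eq_beta {a b : ℝ} (ha : 0 < a) (hb : 0 < b) :
    betaFn a b = ProbabilityTheory.beta a b := by
  rw [ProbabilityTheory.beta_eq_betaIntegralReal a b ha hb, Complex.betaIntegral, betaFn,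
    ← Complex.ofReal_re (∫ v in (0:ℝ)..1, v ^ (a - 1) * (1 - v) ^ (b - 1)),
    ← intervalIntegral.integral_ofReal]
  congr 1
  refine intervalIntegral.integral_congr fun v hv => ?_
  rw [Set.uIcc_of_le zero_le_one] at hv
  have h1 : 0 ≤ 1 - v := sub_nonneg.2 hv.2
  simp only [Complex.ofReal_mul, Complex.ofReal_cpow hv.1, Complex.ofReal_cpow h1]
  push_cast
  rfl

theorem betaFn_pos {a b : ℝ} (ha : 0 < a) (hb : 0 < b) : 0 < betaFn a b := by
  rw [betaFn_eq_beta ha hb]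
  exact ProbabilityTheory.beta_pos ha hb

theorem betaFn_add_one_left {a b : ℝ} (ha : 0 < a) (hb : 0 < b) :
    betaFn (a + 1) b = a / (a + b) * betaFn a b := by
  have hab : 0 < a + b := add_pos ha hb
  have hG := (Real.Gamma_pos_of_pos hab).ne'
  rw [betaFn_eq_beta (by linarith) hb, betaFn_eq_beta ha hb, ProbabilityTheory.beta,
    ProbabilityTheory.beta, add_right_comm, Real.Gamma_add_one ha.ne', Real.Gamma_add_one hab.ne']
  field_simp

theorem betaFn_comm {a b : ℝ} (ha : 0 < a) (hb : 0 < b) : betaFn a b = betaFn b a := by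
  rw [betaFn_eq_beta ha hb, betaFn_eq_beta hb ha, ProbabilityTheory.beta, ProbabilityTheory.beta,
    mul_comm, add_comm]

theorem betaFn_add_one_right {a b : ℝ} (ha : 0 < a) (hb : 0 < b) :
    betaFn a (b + 1) = b / (a + b) * betaFn a b := by
  rw [betaFn_comm ha (by linarith), betaFn_add_one_left hb ha, betaFn_comm ha hb, add_comm a b]

theorem betaFn_add_one_left_le {a b : ℝ} (ha : 0 < a) (hb : 0 < b) :
    betaFn (a + 1) b ≤ betaFn a b := by
  rw [betaFn_add_one_left ha hb]
  refine mul_le_of_le_one_left (betaFn_pos ha hb).le ?_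
  rw [div_le_one (by linarith)]
  linarith

theorem betaFn_le_add_one_left {a b N : ℝ} (ha : 1 ≤ a) (hb : 0 < b) (hN : a + b ≤ N) :
    betaFn a b / N ≤ betaFn (a + 1) b := by
  have hab : 0 < a + b := by linarith
  rw [betaFn_add_one_left (by linarith) hb, div_eq_inv_mul]
  refine mul_le_mul_of_nonneg_right ?_ (betaFn_pos (by linarith) hb).le
  rw [← one_div]
  gcongr

/-- Two-sided bounds for `B(a+i+1, b+j+1)` relative to `B(a+1, b+1)`. -/
theorem betaFn_add_nat_bounds {a b : ℝ} (ha : 0 < a) (hb : 0 < b) (i j : ℕ) :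
    betaFn (a + 1) (b + 1) / ((i + j + 1).factorial * (1 + (a + b)) ^ (i + j))
        ≤ betaFn (a + 1 + i) (b + 1 + j) ∧
      betaFn (a + 1 + i) (b + 1 + j) ≤ betaFn (a + 1) (b + 1) := by
  have step : ∀ {x y : ℝ} (m : ℕ), 1 ≤ x → 0 < y → x + y = a + b + (m + 2) →
      betaFn (a + 1) (b + 1) / ((m + 1).factorial * (1 + (a + b)) ^ m) ≤ betaFn x y ∧
        betaFn x y ≤ betaFn (a + 1) (b + 1) →
      betaFn (a + 1) (b + 1) / ((m + 1 + 1).factorial * (1 + (a + b)) ^ (m + 1))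
        ≤ betaFn (x + 1) y ∧ betaFn (x + 1) y ≤ betaFn (a + 1) (b + 1) := by
    intro x y m hx hy hxy h
    refine ⟨?_, (betaFn_add_one_left_le (by linarith) hy).trans h.2⟩
    have hm : (0 : ℝ) ≤ m := m.cast_nonneg
    refine le_trans ?_ (betaFn_le_add_one_left (N := (m + 2) * (1 + (a + b))) hx hy
      (by nlinarith))
    refine le_trans (le_of_eq ?_) (div_le_div_of_nonneg_right h.1 (by positivity))
    rw [div_div, Nat.factorial_succ (m + 1), pow_succ]
    push_cast
    congr 1
    ring
  induction j with
  | zero =>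
    induction i with
    | zero => simp
    | succ i ih =>
      have := step (i + 0) (by linarith [i.cast_nonneg (α := ℝ)]) (by simp; linarith)
        (by push_cast; ring) ih
      simpa [← add_assoc] using this
  | succ j ih =>
    have hi := i.cast_nonneg (α := ℝ)
    have hj := j.cast_nonneg (α := ℝ)
    rw [betaFn_comm (a := a + 1 + i) (by linarith) (by linarith)] at ih
    have := step (i + j) (by linarith) (by linarith) (by push_cast; ring) ih
    rw [betaFn_comm (a := b + 1 + j + 1) (by linarith) (by linarith)] at this
    simpa [← add_assoc] using this

/-- Lemma 1 (interior group): for `n ≥ 2`, `1 ≤ y ≤ n-1`, there are constants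
`c1, c2 > 0` (depending only on `n, y`; in fact `c2 = 1` works) with
`c1 r p q / (1+r)^(n-1) ≤ B(y+rp, n-y+rq)/B(rp, rq) ≤ c2 r p q / (1+r)`. -/
theorem interior_betaBinom_bounds (n y : ℕ) (hn : 2 ≤ n) (hy1 : 1 ≤ y) (hy2 : y ≤ n - 1) :
    ∃ c1 c2 : ℝ, 0 < c1 ∧ 0 < c2 ∧ c2 = 1 ∧
      ∀ r : ℝ, 0 < r → ∀ p ∈ Set.Ioo (0:ℝ) 1,
        c1 * (r * p * (1 - p)) / (1 + r) ^ (n - 1)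
            ≤ betaFn ((y : ℝ) + r * p) ((n : ℝ) - (y : ℝ) + r * (1 - p)) /
                betaFn (r * p) (r * (1 - p)) ∧
          betaFn ((y : ℝ) + r * p) ((n : ℝ) - (y : ℝ) + r * (1 - p)) /
              betaFn (r * p) (r * (1 - p))
            ≤ c2 * (r * p * (1 - p)) / (1 + r) := by
  obtain ⟨i, rfl⟩ := Nat.exists_eq_add_of_le' hy1
  obtain ⟨j, rfl⟩ : ∃ j, n = i + j + 2 := ⟨n - i - 2, by omega⟩
  refine ⟨1 / (i + j + 1).factorial, 1, by positivity, one_pos, rfl, fun r hr p hp => ?_⟩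
  have ha : 0 < r * p := mul_pos hr hp.1
  have hb : 0 < r * (1 - p) := mul_pos hr (sub_pos.2 hp.2)
  have hB := betaFn_pos ha hb
  have hbase : betaFn (r * p + 1) (r * (1 - p) + 1)
      = r * p * (1 - p) / (1 + r) * betaFn (r * p) (r * (1 - p)) := by
    rw [betaFn_add_one_left ha (by linarith), betaFn_add_one_right ha hb]
    have h1 : r * p + (r * (1 - p) + 1) = 1 + r := by ring
    have h2 : r * p + r * (1 - p) = r := by ring
    rw [h1, h2]
    field_simp
  have hx : ((i + 1 : ℕ) : ℝ) + r * p = r * p + 1 + i := by push_cast; ring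
  have hy : ((i + j + 2 : ℕ) : ℝ) - ((i + 1 : ℕ) : ℝ) + r * (1 - p) = r * (1 - p) + 1 + j := by
    push_cast; ring
  have hsum : r * p + r * (1 - p) = r := by ring
  have hbounds := betaFn_add_nat_bounds ha hb i j
  rw [hbase, hsum] at hbounds
  rw [hx, hy, le_div_iff₀ hB, div_le_iff₀ hB]
  refine ⟨le_trans (le_of_eq ?_) hbounds.1, hbounds.2.trans_eq (by rw [one_mul])⟩
  rw [show i + j + 2 - 1 = i + j + 1 from rfl, pow_succ]
  field_simp
end

section
/- Let n ≥ 1 be an integer, p ∈ (0,1), and q = 1−p. Then for all r > 0: p^n ≤ B(n + r·p, r·q)/B(r·p, r·q) ≤ p, and q^n ≤ B(r·p, n + r·q)/B(r·p, r·q) ≤ q. -/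
open MeasureTheory Real Filter Finset

theorem ofReal_betaFn (a b : ℝ) : ((betaFn a b : ℝ) : ℂ) = Complex.betaIntegral a b := by
  rw [betaFn, Complex.betaIntegral, ← intervalIntegral.integral_ofReal]
  refine intervalIntegral.integral_congr fun x hx => ?_
  rw [Set.uIcc_of_le zero_le_one] at hx
  have h0 : 0 ≤ x := hx.1
  have h1 : 0 ≤ 1 - x := sub_nonneg.2 hx.2
  rw [Complex.ofReal_mul, Complex.ofReal_cpow h0, Complex.ofReal_cpow h1]
  push_cast
  rfl

theorem betaFn_one_add {a b : ℝ} (ha : 0 < a) (hb : 0 < b) :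
    betaFn (1 + a) b = a / (a + b) * betaFn a b := by
  rw [betaFn_eq_beta (by positivity) hb, betaFn_eq_beta ha hb, ProbabilityTheory.beta,
    ProbabilityTheory.beta, add_comm 1 a, add_right_comm, Real.Gamma_add_one ha.ne',
    Real.Gamma_add_one (by positivity)]
  have := (Real.Gamma_pos_of_pos (add_pos ha hb)).ne'
  field_simp

/-- Adding `n` successes to a Beta prior with mean `p` multiplies the Beta function by a factor
between `p ^ n` and `p`. -/
theorem betaFn_nat_add_div_bounds {n : ℕ} (hn : 1 ≤ n) {p r : ℝ} (hp0 : 0 < p) (hp1 : p < 1)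
    (hr : 0 < r) :
    p ^ n ≤ betaFn ((n : ℝ) + r * p) (r * (1 - p)) / betaFn (r * p) (r * (1 - p)) ∧
      betaFn ((n : ℝ) + r * p) (r * (1 - p)) / betaFn (r * p) (r * (1 - p)) ≤ p := by
  have ha : 0 < r * p := mul_pos hr hp0
  have hb : 0 < r * (1 - p) := mul_pos hr (sub_pos.2 hp1)
  have hB := betaFn_pos ha hb
  rw [le_div_iff₀ hB, div_le_iff₀ hB]
  induction n, hn using Nat.le_induction with
  | base =>
    have h : r * p / (r * p + r * (1 - p)) = p := by
      rw [show r * p + r * (1 - p) = r by ring]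
      field_simp
    rw [Nat.cast_one, betaFn_one_add ha hb, h, pow_one]
    exact ⟨le_rfl, le_rfl⟩
  | succ n _ ih =>
    have hna : 0 < (n : ℝ) + r * p := by positivity
    have hpos := betaFn_pos hna hb
    have hden : (n : ℝ) + r * p + r * (1 - p) = n + r := by ring
    have hnr : 0 < (n : ℝ) + r := by positivity
    have hlow : p ≤ ((n : ℝ) + r * p) / (n + r) := by
      rw [le_div_iff₀ hnr]
      nlinarith [mul_le_of_le_one_right n.cast_nonneg hp1.le (α := ℝ)]
    have hhigh : ((n : ℝ) + r * p) / (n + r) ≤ 1 := by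
      rw [div_le_one hnr]
      nlinarith
    rw [show ((n + 1 : ℕ) : ℝ) + r * p = 1 + (n + r * p) by push_cast; ring,
      betaFn_one_add hna hb, hden]
    constructor
    · calc p ^ (n + 1) * betaFn (r * p) (r * (1 - p))
          = p * (p ^ n * betaFn (r * p) (r * (1 - p))) := by ring
        _ ≤ _ := mul_le_mul hlow ih.1 (by positivity) (by positivity)
    · exact (mul_le_of_le_one_left hpos.le hhigh).trans ih.2

/-- Lemma 1 (extreme groups): for `n ≥ 1`, `p ∈ (0,1)`, `q = 1-p`, and all `r > 0`:
`p^n ≤ B(n+rp, rq)/B(rp, rq) ≤ p` and `q^n ≤ B(rp, n+rq)/B(rp, rq) ≤ q`. -/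
theorem extreme_betaBinom_bounds (n : ℕ) (hn : 1 ≤ n) (p : ℝ) (hp : p ∈ Set.Ioo (0:ℝ) 1)
    (r : ℝ) (hr : 0 < r) :
    (p ^ n ≤ betaFn ((n : ℝ) + r * p) (r * (1 - p)) / betaFn (r * p) (r * (1 - p)) ∧
      betaFn ((n : ℝ) + r * p) (r * (1 - p)) / betaFn (r * p) (r * (1 - p)) ≤ p) ∧
    ((1 - p) ^ n ≤ betaFn (r * p) ((n : ℝ) + r * (1 - p)) / betaFn (r * p) (r * (1 - p)) ∧
      betaFn (r * p) ((n : ℝ) + r * (1 - p)) / betaFn (r * p) (r * (1 - p)) ≤ 1 - p) := by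
  refine ⟨betaFn_nat_add_div_bounds hn hp.1 hp.2 hr, ?_⟩
  have ha : 0 < r * p := mul_pos hr hp.1
  have hb : 0 < r * (1 - p) := mul_pos hr (sub_pos.2 hp.2)
  have h := betaFn_nat_add_div_bounds hn (sub_pos.2 hp.2) (sub_lt_self 1 hp.1) hr
  rw [sub_sub_cancel] at h
  rwa [betaFn_comm ha hb, betaFn_comm ha (by positivity)]
end

section
/- Let n ≥ 1 and y be integers with 0 ≤ y ≤ n, let p ∈ (0,1), and q = 1−p. Then lim_{r→∞} B(y + r·p, n−y + r·q)/B(r·p, r·q) = p^y · q^(n−y). In particular, the Beta-Binomial probability mass function converges to the Binomial probability mass function (up to the binomial coefficient) as r → ∞. -/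
open MeasureTheory Real Filter Finset

theorem betaFn_eq_Gamma_mul_div {a b : ℝ} (ha : 0 < a) (hb : 0 < b) :
    betaFn a b = Real.Gamma a * Real.Gamma b / Real.Gamma (a + b) := by
  change _ = ProbabilityTheory.beta a b
  rw [ProbabilityTheory.beta_eq_betaIntegralReal a b ha hb, Complex.betaIntegral, betaFn,
    ← Complex.ofReal_re (∫ v in (0:ℝ)..1, v ^ (a - 1) * (1 - v) ^ (b - 1)),
    ← intervalIntegral.integral_ofReal]
  congr 1
  refine intervalIntegral.integral_congr fun v hv => ?_
  rw [Set.uIcc_of_le zero_le_one] at hv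
  have h₁ : 0 ≤ 1 - v := sub_nonneg.mpr hv.2
  simp only [Complex.ofReal_mul, Complex.ofReal_cpow hv.1, Complex.ofReal_cpow h₁,
    Complex.ofReal_sub, Complex.ofReal_one]

theorem Gamma_natCast_add_eq_prod_mul {a : ℝ} (ha : 0 < a) (k : ℕ) :
    Real.Gamma (k + a) = (∏ i ∈ range k, (a + i)) * Real.Gamma a := by
  induction k with
  | zero => simp
  | succ k ih =>
    have h : ((k + 1 : ℕ) : ℝ) + a = (k + a) + 1 := by push_cast; ring
    rw [h, Real.Gamma_add_one (by positivity), ih, prod_range_succ]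
    ring

theorem tendsto_prod_range_mul_add_div_pow (c : ℝ) (k : ℕ) :
    Tendsto (fun r : ℝ => (∏ i ∈ range k, (r * c + i)) / r ^ k) atTop (nhds (c ^ k)) := by
  have h : Tendsto (fun r : ℝ => ∏ i ∈ range k, (c + i / r)) atTop
      (nhds (∏ _i ∈ range k, c)) := by
    refine tendsto_finsetProd _ fun i _ => ?_
    simpa using tendsto_const_nhds.add (tendsto_const_nhds.div_atTop (a := (i : ℝ)) tendsto_id)
  rw [prod_const, card_range] at h
  refine h.congr' ?_
  filter_upwards [eventually_gt_atTop 0] with r hr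
  rw [← card_range k, ← prod_const, card_range, ← prod_div_distrib]
  refine prod_congr rfl fun i _ => ?_
  field_simp

/-- The ratio of Beta functions as a ratio of rising factorials. -/
theorem betaFn_natCast_add_div_betaFn {a b : ℝ} (ha : 0 < a) (hb : 0 < b) (k l : ℕ) :
    betaFn (k + a) (l + b) / betaFn a b =
      (∏ i ∈ range k, (a + i)) * (∏ i ∈ range l, (b + i)) /
        ∏ i ∈ range (k + l), (a + b + i) := by
  have hs : (k + a) + (l + b) = ((k + l : ℕ) : ℝ) + (a + b) := by push_cast; ring
  rw [betaFn_eq_Gamma_mul_div (by positivity) (by positivity), betaFn_eq_Gamma_mul_div ha hb, hs,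
    Gamma_natCast_add_eq_prod_mul ha, Gamma_natCast_add_eq_prod_mul hb,
    Gamma_natCast_add_eq_prod_mul (add_pos ha hb)]
  have h₁ := (Real.Gamma_pos_of_pos ha).ne'
  have h₂ := (Real.Gamma_pos_of_pos hb).ne'
  have h₃ := (Real.Gamma_pos_of_pos (add_pos ha hb)).ne'
  have h₄ : ∏ i ∈ range (k + l), (a + b + (i : ℝ)) ≠ 0 :=
    (prod_pos fun i _ => by positivity).ne'
  field_simp

/-- The Beta-Binomial mass function (up to the binomial coefficient) converges to the
Binomial one as `r → ∞`: `B(y+rp, n-y+rq)/B(rp, rq) → p^y q^(n-y)`. -/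
theorem betaBinom_tendsto_binom (n y : ℕ) (hn : 1 ≤ n) (hy : y ≤ n)
    (p : ℝ) (hp : p ∈ Set.Ioo (0:ℝ) 1) :
    Tendsto
      (fun r : ℝ =>
        betaFn ((y : ℝ) + r * p) ((n : ℝ) - (y : ℝ) + r * (1 - p)) /
          betaFn (r * p) (r * (1 - p)))
      atTop (nhds (p ^ y * (1 - p) ^ (n - y))) := by
  obtain ⟨hp₀, hp₁⟩ := hp
  have hq : 0 < 1 - p := sub_pos.mpr hp₁
  have h := ((tendsto_prod_range_mul_add_div_pow p y).mul
    (tendsto_prod_range_mul_add_div_pow (1 - p) (n - y))).div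
    (tendsto_prod_range_mul_add_div_pow 1 (y + (n - y))) (by simp)
  rw [one_pow, div_one] at h
  refine h.congr' ?_
  filter_upwards [eventually_gt_atTop 0] with r hr
  have hsum : r * p + r * (1 - p) = r * 1 := by ring
  rw [← Nat.cast_sub hy, betaFn_natCast_add_div_betaFn (mul_pos hr hp₀) (mul_pos hr hq), hsum,
    Pi.div_apply, div_mul_div_comm, ← pow_add, div_div_div_cancel_right₀ (by positivity)]
end

section
/- Suppose all k groups are interior, i.e., n_j ≥ 2 and 1 ≤ y_j ≤ n_j − 1 for all j = 1,…,k. Then there exist constants c1, c2 > 0, depending only on the data (n_1,…,n_k, y_1,…,y_k), such that for all r > 0 and all β ∈ ℝ^m: c1 · r^k · (∏_{j=1}^k p_j^E(β)·q_j^E(β)) / (1+r)^{Σ_{j=1}^k (n_j − 1)} ≤ L(r, β) ≤ c2 · r^k · (∏_{j=1}^k p_j^E(β)·q_j^E(β)) / (1+r)^k. In particular both bounds factor into a function of r times a function of β. -/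
open MeasureTheory Real Filter Finset

theorem Gamma_add_nat_succ {s : ℝ} (hs : 0 < s) (a : ℕ) :
    Real.Gamma (s + (a + 1)) = Real.Gamma s * (s * ∏ i ∈ range a, (s + 1 + i)) := by
  induction a with
  | zero => simp [Real.Gamma_add_one hs.ne', mul_comm]
  | succ a ih =>
    have h : s + (a + 1) ≠ 0 := by positivity
    push_cast
    rw [← add_assoc, Real.Gamma_add_one h, ih, prod_range_succ]
    ring

theorem one_le_prod_add_one {s : ℝ} (hs : 0 ≤ s) (a : ℕ) :
    1 ≤ ∏ i ∈ range a, (s + 1 + i) :=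
  Finset.one_le_prod fun i _ => by
    have : (0 : ℝ) ≤ i := i.cast_nonneg
    linarith

theorem pow_le_prod_add_one {r : ℝ} (hr : 0 ≤ r) (a : ℕ) :
    (1 + r) ^ a ≤ ∏ i ∈ range a, (r + 1 + i) := by
  calc (1 + r) ^ a = ∏ _i ∈ range a, (1 + r) := by simp
    _ ≤ _ := ?_
  refine prod_le_prod (fun _ _ => by positivity) fun i _ => ?_
  have : (0 : ℝ) ≤ i := i.cast_nonneg
  linarith

theorem prod_add_one_le {s r : ℝ} (hs : 0 ≤ s) (hsr : s ≤ r) (a : ℕ) :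
    ∏ i ∈ range a, (s + 1 + i) ≤ a.factorial * (1 + r) ^ a := by
  induction a with
  | zero => simp
  | succ a ih =>
    have hr : 0 ≤ r := hs.trans hsr
    rw [prod_range_succ, Nat.factorial_succ, pow_succ]
    calc _ ≤ (a.factorial * (1 + r) ^ a) * ((a + 1) * (1 + r)) := by
          refine mul_le_mul ih ?_ (by positivity) (by positivity)
          nlinarith [mul_nonneg (a.cast_nonneg : (0 : ℝ) ≤ a) hr]
      _ = _ := by push_cast; ring

theorem betaFn_add_nat_div {s t : ℝ} (hs : 0 < s) (ht : 0 < t) (a b : ℕ) :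
    betaFn (s + (a + 1)) (t + (b + 1)) / betaFn s t =
      s * t * ((∏ i ∈ range a, (s + 1 + i)) * ∏ i ∈ range b, (t + 1 + i)) /
        ((s + t) * ∏ i ∈ range (a + b + 1), (s + t + 1 + i)) := by
  have hst : s + (a + 1) + (t + (b + 1)) = s + t + (((a + b + 1 : ℕ) : ℝ) + 1) := by
    push_cast; ring
  rw [betaFn_eq_beta hs ht, betaFn_eq_beta (by positivity) (by positivity)]
  unfold ProbabilityTheory.beta
  rw [hst, Gamma_add_nat_succ hs, Gamma_add_nat_succ ht, Gamma_add_nat_succ (add_pos hs ht)]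
  have h1 := (Real.Gamma_pos_of_pos hs).ne'
  have h2 := (Real.Gamma_pos_of_pos ht).ne'
  have h3 := (Real.Gamma_pos_of_pos (add_pos hs ht)).ne'
  have h4 : ∏ i ∈ range (a + b + 1), (s + t + 1 + i) ≠ 0 := by positivity
  have h5 : s + t ≠ 0 := by positivity
  field_simp

/-- Two-sided bound for the ratio of Beta functions of an interior group. -/
theorem betaFn_ratio_bounds {r p : ℝ} (hr : 0 < r) (hp : 0 < p) (hp1 : p < 1) (a b : ℕ) :
    1 / (a + b + 1).factorial * (r * (p * (1 - p)) / (1 + r) ^ (a + b + 1)) ≤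
        betaFn (r * p + (a + 1)) (r * (1 - p) + (b + 1)) / betaFn (r * p) (r * (1 - p)) ∧
      betaFn (r * p + (a + 1)) (r * (1 - p) + (b + 1)) / betaFn (r * p) (r * (1 - p)) ≤
        (a.factorial * b.factorial) * (r * (p * (1 - p)) / (1 + r)) := by
  have hq : 0 < 1 - p := sub_pos.2 hp1
  have hs : 0 < r * p := mul_pos hr hp
  have ht : 0 < r * (1 - p) := mul_pos hr hq
  have hst : r * p + r * (1 - p) = r := by ring
  rw [betaFn_add_nat_div hs ht, hst]
  set A := ∏ i ∈ range a, (r * p + 1 + i)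
  set B := ∏ i ∈ range b, (r * (1 - p) + 1 + i)
  set D := ∏ i ∈ range (a + b + 1), (r + 1 + i)
  have hA : 1 ≤ A := one_le_prod_add_one hs.le a
  have hB : 1 ≤ B := one_le_prod_add_one ht.le b
  have hA' : A ≤ a.factorial * (1 + r) ^ a := prod_add_one_le hs.le (by linarith) a
  have hB' : B ≤ b.factorial * (1 + r) ^ b := prod_add_one_le ht.le (by linarith) b
  have hD : (1 + r) ^ (a + b + 1) ≤ D := pow_le_prod_add_one hr.le _
  have hD' : D ≤ (a + b + 1).factorial * (1 + r) ^ (a + b + 1) := prod_add_one_le hr.le le_rfl _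
  have hD0 : 0 < D := lt_of_lt_of_le (by positivity) hD
  have hw : 0 < r * (p * (1 - p)) := by positivity
  have key : r * p * (r * (1 - p)) * (A * B) / (r * D) = r * (p * (1 - p)) * (A * B / D) := by
    field_simp
  rw [key]
  constructor
  · calc _ = r * (p * (1 - p)) * (1 / ((a + b + 1).factorial * (1 + r) ^ (a + b + 1))) := by
          field_simp
      _ ≤ _ := by
          gcongr
          nlinarith
  · calc _ ≤ r * (p * (1 - p)) *
            (a.factorial * (1 + r) ^ a * (b.factorial * (1 + r) ^ b) / (1 + r) ^ (a + b + 1)) := by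
          gcongr
      _ = _ := by
          rw [pow_succ, pow_add]
          field_simp

theorem logistic_pos (t : ℝ) : 0 < logistic t := by
  unfold logistic
  positivity

theorem logistic_lt_one (t : ℝ) : logistic t < 1 := by
  unfold logistic
  rw [div_lt_one (by positivity)]
  linarith

/-- Lemma 2: when all `k` groups are interior, the likelihood satisfies
`c1 r^k (∏ pⱼᴱ qⱼᴱ)/(1+r)^{Σ(nⱼ-1)} ≤ L(r,β) ≤ c2 r^k (∏ pⱼᴱ qⱼᴱ)/(1+r)^k`. -/
theorem likelihood_bounds_all_interior (k m : ℕ) (x : Fin k → Fin m → ℝ) (n y : Fin k → ℕ)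
    (hint : ∀ j, 2 ≤ n j ∧ 1 ≤ y j ∧ y j ≤ n j - 1) :
    ∃ c1 c2 : ℝ, 0 < c1 ∧ 0 < c2 ∧
      ∀ r : ℝ, 0 < r → ∀ β : Fin m → ℝ,
        c1 * (r ^ k * (∏ j : Fin k, pE x j β * (1 - pE x j β)) /
              (1 + r) ^ (∑ j : Fin k, (n j - 1)))
            ≤ bbL x n y r β ∧
          bbL x n y r β
            ≤ c2 * (r ^ k * (∏ j : Fin k, pE x j β * (1 - pE x j β)) / (1 + r) ^ k) := by
  have hC : ∀ j, (0 : ℝ) < (n j).choose (y j) := fun j =>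
    Nat.cast_pos.2 (Nat.choose_pos ((hint j).2.2.trans (Nat.sub_le _ _)))
  refine ⟨∏ j, ((n j).choose (y j) * (1 / (n j - 1).factorial) : ℝ),
    ∏ j, ((n j).choose (y j) * ((y j - 1).factorial * (n j - y j - 1).factorial) : ℝ),
    prod_pos fun j _ => mul_pos (hC j) (by positivity),
    prod_pos fun j _ => mul_pos (hC j) (by positivity), fun r hr β => ?_⟩
  have hp : ∀ j, 0 < pE x j β := fun j => logistic_pos _
  have hp1 : ∀ j, pE x j β < 1 := fun j => logistic_lt_one _
  have hw : ∀ j, 0 ≤ r * (pE x j β * (1 - pE x j β)) := fun j =>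
    mul_nonneg hr.le (mul_nonneg (hp j).le (sub_nonneg.2 (hp1 j).le))
  have hrk : r ^ k * ∏ j, pE x j β * (1 - pE x j β) =
      ∏ j, r * (pE x j β * (1 - pE x j β)) := by
    rw [prod_mul_distrib (f := fun _ => r)]
    simp
  have hk : (1 + r) ^ k = ∏ _j : Fin k, (1 + r) := by simp
  have hbound := fun j => betaFn_ratio_bounds hr (hp j) (hp1 j) (y j - 1) (n j - y j - 1)
  have hsucc : ∀ j, y j - 1 + (n j - y j - 1) + 1 = n j - 1 := fun j => by
    have := hint j
    omega
  have hy : ∀ j, ((y j - 1 : ℕ) : ℝ) + 1 = y j := fun j => by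
    rw [Nat.cast_sub (hint j).2.1]
    simp
  have hny : ∀ j, ((n j - y j - 1 : ℕ) : ℝ) + 1 = n j - y j := fun j => by
    have := hint j
    rw [Nat.cast_sub (by omega), Nat.cast_sub (by omega)]
    simp
  simp only [hsucc, hy, hny] at hbound
  rw [hrk, hk, ← prod_pow_eq_pow_sum, ← prod_div_distrib, ← prod_div_distrib, ← prod_mul_distrib,
    ← prod_mul_distrib]
  unfold bbL
  have hpos : ∀ j, 0 ≤ ((n j).choose (y j) * (1 / (n j - 1).factorial) : ℝ) *
      (r * (pE x j β * (1 - pE x j β)) / (1 + r) ^ (n j - 1)) := fun j =>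
    mul_nonneg (by positivity) (div_nonneg (hw j) (by positivity))
  have hlo : ∀ j, ((n j).choose (y j) * (1 / (n j - 1).factorial) : ℝ) *
      (r * (pE x j β * (1 - pE x j β)) / (1 + r) ^ (n j - 1)) ≤ (n j).choose (y j) *
      betaFn (y j + r * pE x j β) ((n j - y j) + r * (1 - pE x j β)) /
      betaFn (r * pE x j β) (r * (1 - pE x j β)) := fun j => by
    rw [mul_assoc, mul_div_assoc ((n j).choose (y j) : ℝ), add_comm (y j : ℝ), add_comm ((n j : ℝ) - y j)]
    exact mul_le_mul_of_nonneg_left (hbound j).1 (hC j).le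
  refine ⟨prod_le_prod (fun j _ => hpos j) fun j _ => hlo j,
    prod_le_prod (fun j _ => (hpos j).trans (hlo j)) fun j _ => ?_⟩
  rw [mul_assoc, mul_div_assoc ((n j).choose (y j) : ℝ), add_comm (y j : ℝ), add_comm ((n j : ℝ) - y j)]
  exact mul_le_mul_of_nonneg_left (hbound j).2 (hC j).le
end

section
/- Let x_1,…,x_k ∈ ℝ^m (k ≥ m ≥ 1) and let X be the k×m matrix with rows x_jᵀ. Then ∫_{ℝ^m} ∏_{j=1}^k exp(x_jᵀβ) / (1 + exp(x_jᵀβ))^2 dβ < ∞ if and only if rank(X) = m. -/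
open MeasureTheory Real Filter Finset

theorem exp_div_one_add_exp_sq_le_exp_neg_abs (t : ℝ) :
    Real.exp t / (1 + Real.exp t) ^ 2 ≤ Real.exp (-|t|) := by
  have h := Real.exp_pos t
  rcases abs_cases t with ⟨ht, -⟩ | ⟨ht, -⟩
  · rw [ht, Real.exp_neg, div_le_iff₀ (by positivity), inv_mul_eq_div, le_div_iff₀ h]
    nlinarith
  · rw [ht, neg_neg, div_le_iff₀ (by positivity)]
    nlinarith [sq_nonneg (Real.exp t)]

theorem prod_exp_div_one_add_exp_sq_pos {ι : Type*} [Fintype ι] (t : ι → ℝ) :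
    0 < ∏ j, Real.exp (t j) / (1 + Real.exp (t j)) ^ 2 :=
  Finset.prod_pos fun _ _ => by positivity

theorem prod_exp_div_one_add_exp_sq_le_exp_neg_norm {ι : Type*} [Fintype ι] [Nonempty ι]
    (t : ι → ℝ) :
    ∏ j, Real.exp (t j) / (1 + Real.exp (t j)) ^ 2 ≤ Real.exp (-‖t‖) := by
  calc ∏ j, Real.exp (t j) / (1 + Real.exp (t j)) ^ 2
      ≤ ∏ j, Real.exp (-|t j|) :=
        Finset.prod_le_prod (fun _ _ => by positivity)
          fun j _ => exp_div_one_add_exp_sq_le_exp_neg_abs (t j)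
    _ = Real.exp (-∑ j, |t j|) := by rw [← Real.exp_sum, Finset.sum_neg_distrib]
    _ ≤ Real.exp (-‖t‖) := by
        gcongr
        exact (pi_norm_le_iff_of_nonempty _).2 fun j =>
          Finset.single_le_sum (f := fun j => |t j|) (fun _ _ => abs_nonneg _) (Finset.mem_univ j)

theorem integrable_exp_neg_mul_norm {E : Type*} [NormedAddCommGroup E] [NormedSpace ℝ E]
    [FiniteDimensional ℝ E] [MeasurableSpace E] [BorelSpace E] (μ : Measure E)
    [μ.IsAddHaarMeasure] {c : ℝ} (hc : 0 < c) :
    Integrable (fun v : E => Real.exp (-(c * ‖v‖))) μ := by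
  set n := Module.finrank ℝ E + 1 with hn
  have hint : Integrable (fun v : E => (1 + ‖v‖) ^ (-(n : ℝ))) μ :=
    integrable_one_add_norm (by rw [hn]; push_cast; linarith)
  refine (hint.const_mul (Real.exp c * n.factorial / c ^ n)).mono'
    (by fun_prop) (.of_forall fun v => ?_)
  have hv : 0 < 1 + ‖v‖ := by positivity
  have h := Real.pow_div_factorial_le_exp (c * (1 + ‖v‖)) (by positivity) n
  rw [mul_add, mul_one, Real.exp_add, ← mul_one_add, mul_pow,
    div_le_iff₀ (by positivity)] at h
  rw [Real.norm_of_nonneg (Real.exp_pos _).le, Real.rpow_neg hv.le, Real.rpow_natCast,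
    Real.exp_neg, ← div_eq_mul_inv, div_div, inv_eq_one_div, div_le_div_iff₀ (by positivity)
    (by positivity)]
  linarith

/-- A positive function that is invariant under a nonzero translation is not integrable:
otherwise the translation would be conservative for the finite measure with this density,
whereas points of a small ball never return to it. -/
theorem lintegral_eq_top_of_translation_invariant {E : Type*} [NormedAddCommGroup E]
    [NormedSpace ℝ E] [MeasurableSpace E] [BorelSpace E] (μ : Measure E)
    [μ.IsAddRightInvariant] [μ.IsOpenPosMeasure] {f : E → ENNReal} (hf : Measurable f)
    (hpos : ∀ b, f b ≠ 0) {v : E} (hv : v ≠ 0) (hinv : ∀ b, f (b + v) = f b) :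
    ∫⁻ b, f b ∂μ = ⊤ := by
  by_contra hfin
  have : IsFiniteMeasure (μ.withDensity f) := isFiniteMeasure_withDensity hfin
  have hmp : MeasurePreserving (· + v) (μ.withDensity f) (μ.withDensity f) := by
    refine ⟨by fun_prop, Measure.ext fun s hs => ?_⟩
    have hs' : MeasurableSet ((· + v) ⁻¹' s) := (measurable_add_const v) hs
    rw [Measure.map_apply (by fun_prop) hs, withDensity_apply _ hs', withDensity_apply _ hs,
      ← (measurePreserving_add_right μ v).setLIntegral_comp_preimage hs hf]
    simp only [hinv]
  have hball : (μ.withDensity f) (Metric.ball 0 (‖v‖ / 2)) ≠ 0 := by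
    rw [Ne, withDensity_apply_eq_zero hf]
    simpa [hpos] using (Metric.measure_ball_pos μ (0 : E) (half_pos (norm_pos_iff.2 hv))).ne'
  obtain ⟨b, hb, n, hn, hbn⟩ := hmp.conservative.exists_mem_iterate_mem
    Metric.isOpen_ball.measurableSet.nullMeasurableSet hball
  rw [add_right_iterate, mem_ball_zero_iff] at hbn
  rw [mem_ball_zero_iff] at hb
  have h1 : (1 : ℝ) ≤ n := by exact_mod_cast Nat.one_le_iff_ne_zero.2 hn
  have h2 : ‖n • v‖ = n * ‖v‖ := by rw [← Nat.cast_smul_eq_nsmul ℝ, norm_smul]; simp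
  have h3 : ‖n • v‖ ≤ ‖b + n • v‖ + ‖b‖ := by simpa using norm_sub_le (b + n • v) b
  nlinarith [norm_nonneg v]

theorem Matrix.rank_eq_card_iff_ker_mulVecLin_eq_bot {K ι κ : Type*} [Field K] [Fintype ι]
    [Fintype κ] (A : Matrix ι κ K) :
    A.rank = Fintype.card κ ↔ LinearMap.ker A.mulVecLin = ⊥ := by
  have h := A.mulVecLin.finrank_range_add_finrank_ker
  rw [Module.finrank_fintype_fun_eq_card] at h
  rw [← Submodule.finrank_eq_zero, Matrix.rank]
  lia

/-- The product of logistic densities `∏ⱼ σ'(xⱼᵀβ)` is integrable over `ℝ^m`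
iff the covariate matrix has full rank `m`. -/
theorem logistic_product_integral_finite_iff_fullRank (k m : ℕ) (hm : 1 ≤ m) (hkm : m ≤ k)
    (x : Fin k → Fin m → ℝ) :
    (∫⁻ β : Fin m → ℝ,
        ENNReal.ofReal
          (∏ j : Fin k,
            Real.exp (∑ i, x j i * β i) / (1 + Real.exp (∑ i, x j i * β i)) ^ 2)) < ⊤
      ↔ (Matrix.of x).rank = m := by
  set L := (Matrix.of x).mulVecLin with hL
  have hLx (β : Fin m → ℝ) (j : Fin k) : ∑ i, x j i * β i = L β j := rfl
  have hLc : Continuous L := L.continuous_of_finiteDimensional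
  have hcont : Continuous fun β : Fin m → ℝ =>
      ∏ j : Fin k, Real.exp (L β j) / (1 + Real.exp (L β j)) ^ 2 := by
    refine continuous_finsetProd _ fun j _ => Continuous.div (by fun_prop) (by fun_prop) ?_
    intro β
    positivity
  have hrank := (Matrix.of x).rank_eq_card_iff_ker_mulVecLin_eq_bot
  rw [Fintype.card_fin, ← hL] at hrank
  rw [hrank]
  simp only [hLx]
  constructor
  · intro hfin
    by_contra hker
    obtain ⟨v, hvker, hv⟩ := Submodule.exists_mem_ne_zero_of_ne_bot hker
    rw [LinearMap.mem_ker] at hvker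
    refine hfin.ne (lintegral_eq_top_of_translation_invariant volume
      hcont.measurable.ennreal_ofReal (fun β => ?_) hv fun β => ?_)
    · simpa using prod_exp_div_one_add_exp_sq_pos (L β)
    · simp [hvker]
  · intro hker
    have : Nonempty (Fin k) := ⟨⟨0, by lia⟩⟩
    obtain ⟨K, hK, hanti⟩ := L.exists_antilipschitzWith hker
    have hK' : (0 : ℝ) < K := hK
    refine (Integrable.mono' (integrable_exp_neg_mul_norm volume (inv_pos.2 hK'))
      hcont.aestronglyMeasurable (.of_forall fun β => ?_)).lintegral_lt_top
    rw [Real.norm_of_nonneg (prod_exp_div_one_add_exp_sq_pos (L β)).le]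
    refine (prod_exp_div_one_add_exp_sq_le_exp_neg_norm (L β)).trans ?_
    gcongr
    rw [inv_mul_le_iff₀ hK']
    simpa using hanti.le_mul_dist β 0
end

section
/- Suppose all k groups are interior (n_j ≥ 2 and 1 ≤ y_j ≤ n_j − 1 for all j), and let f be a probability density on (0,∞) that is strictly positive on a set of positive measure. Then ∫_{ℝ^m} ∫_0^∞ f(r) · L(r, β) dr dβ < ∞ if and only if rank(X) = m, where X is the k×m covariate matrix with rows x_1ᵀ,…,x_kᵀ. -/
open MeasureTheory Real Filter Finset

theorem betaFn_eq_Gamma {a b : ℝ} (ha : 0 < a) (hb : 0 < b) :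
    betaFn a b = Gamma a * Gamma b / Gamma (a + b) := by
  have h : ((betaFn a b : ℝ) : ℂ) = Complex.betaIntegral a b := by
    rw [betaFn, ← intervalIntegral.integral_ofReal, Complex.betaIntegral]
    refine intervalIntegral.integral_congr fun v hv => ?_
    rw [Set.uIcc_of_le zero_le_one] at hv
    simp only [Complex.ofReal_mul]
    rw [Complex.ofReal_cpow hv.1, Complex.ofReal_cpow (by linarith [hv.2])]
    push_cast
    rfl
  rw [← Complex.ofReal_re (betaFn a b), h, ← ProbabilityTheory.beta_eq_betaIntegralReal a b ha hb,
    ProbabilityTheory.beta]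

theorem Gamma_add_natCast_eq_prod {a : ℝ} (ha : 0 < a) (n : ℕ) :
    Gamma (a + n) = (∏ i ∈ range n, (a + i)) * Gamma a := by
  induction n with
  | zero => simp
  | succ n ih =>
    rw [prod_range_succ, Nat.cast_succ, ← add_assoc, Gamma_add_one (by positivity), ih]
    ring

theorem betaFn_add_nat_div_betaFn {a b : ℝ} (ha : 0 < a) (hb : 0 < b) (s t : ℕ) :
    betaFn (s + a) (t + b) / betaFn a b =
      (∏ i ∈ range s, (a + i)) * (∏ i ∈ range t, (b + i)) /
        ∏ i ∈ range (s + t), (a + b + i) := by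
  have hsum : (s : ℝ) + a + (t + b) = a + b + ((s + t : ℕ) : ℝ) := by push_cast; ring
  rw [betaFn_eq_Gamma (by positivity) (by positivity), betaFn_eq_Gamma ha hb, hsum,
    add_comm (s : ℝ) a, add_comm (t : ℝ) b, Gamma_add_natCast_eq_prod ha,
    Gamma_add_natCast_eq_prod hb, Gamma_add_natCast_eq_prod (add_pos ha hb)]
  have h1 := (Gamma_pos_of_pos ha).ne'
  have h2 := (Gamma_pos_of_pos hb).ne'
  have h3 := (Gamma_pos_of_pos (add_pos ha hb)).ne'
  have h4 : ∏ i ∈ range (s + t), (a + b + (i : ℝ)) ≠ 0 :=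
    (prod_pos fun i _ => by positivity).ne'
  field_simp

theorem betaFn_ratio_le {a b : ℝ} (ha : 0 < a) (hb : 0 < b) (s t : ℕ) :
    betaFn ((s + 1 : ℕ) + a) ((t + 1 : ℕ) + b) / betaFn a b ≤ a * b / (a + b) ^ 2 := by
  rw [betaFn_add_nat_div_betaFn ha hb, show s + 1 + (t + 1) = (s + (t + 1)) + 1 by ring]
  rw [prod_range_succ' _ s, prod_range_succ' _ t, prod_range_succ' _ (s + (t + 1)),
    prod_range_add _ s, prod_range_succ _ t]
  have h1 : ∏ i ∈ range s, (a + (i + 1 : ℕ)) ≤ ∏ i ∈ range s, (a + b + (i + 1 : ℕ)) :=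
    prod_le_prod (fun i _ => by positivity) fun i _ => by linarith
  have h2 : ∏ i ∈ range t, (b + (i + 1 : ℕ)) ≤ ∏ i ∈ range t, (a + b + (s + i + 1 : ℕ)) :=
    prod_le_prod (fun i _ => by positivity) fun i _ => by
      push_cast; linarith [Nat.cast_nonneg (α := ℝ) s]
  have p1 : 0 < ∏ i ∈ range s, (a + b + ((i + 1 : ℕ) : ℝ)) := prod_pos fun i _ => by positivity
  have p2 : 0 < ∏ i ∈ range t, (a + b + ((s + i + 1 : ℕ) : ℝ)) := prod_pos fun i _ => by positivity
  have q1 : 0 ≤ ∏ i ∈ range s, (a + ((i + 1 : ℕ) : ℝ)) := prod_nonneg fun i _ => by positivity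
  have q2 : 0 ≤ ∏ i ∈ range t, (b + ((i + 1 : ℕ) : ℝ)) := prod_nonneg fun i _ => by positivity
  have h3 : a + b ≤ a + b + ((s + t + 1 : ℕ) : ℝ) := by
    linarith [Nat.cast_nonneg (α := ℝ) (s + t + 1)]
  have hm := mul_le_mul (mul_le_mul h1 h2 q2 p1.le) h3 (by positivity) (by positivity)
  rw [div_le_div_iff₀ (by positivity) (by positivity)]
  calc _ = a * b * (a + b) * ((∏ i ∈ range s, (a + ((i + 1 : ℕ) : ℝ))) *
        (∏ i ∈ range t, (b + ((i + 1 : ℕ) : ℝ))) * (a + b)) := by push_cast; ring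
    _ ≤ _ := mul_le_mul_of_nonneg_left hm (by positivity)
    _ = _ := by push_cast; ring

theorem le_betaFn_ratio {a b : ℝ} (ha : 0 < a) (hb : 0 < b) (s t : ℕ) :
    (a * b / ∏ i ∈ range (s + 1 + (t + 1)), (a + b + i)) * (s.factorial * t.factorial) ≤
      betaFn ((s + 1 : ℕ) + a) ((t + 1 : ℕ) + b) / betaFn a b := by
  have key : ∀ {c : ℝ}, 0 < c → ∀ n : ℕ,
      c * n.factorial ≤ ∏ i ∈ range (n + 1), (c + i) := by
    intro c hc n
    rw [prod_range_succ', ← prod_range_add_one_eq_factorial, mul_comm]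
    push_cast
    rw [add_zero]
    refine mul_le_mul_of_nonneg_right (prod_le_prod (fun i _ => by positivity) fun i _ => ?_) hc.le
    linarith
  rw [betaFn_add_nat_div_betaFn ha hb, div_mul_eq_mul_div]
  have hden : 0 < ∏ i ∈ range (s + 1 + (t + 1)), (a + b + (i : ℝ)) :=
    prod_pos fun i _ => by positivity
  refine div_le_div_of_nonneg_right ?_ hden.le
  calc _ = (a * s.factorial) * (b * t.factorial) := by ring
    _ ≤ _ := mul_le_mul (key ha s) (key hb t) (by positivity)
      (prod_nonneg fun i _ => by positivity)

theorem one_sub_logistic (t : ℝ) : 1 - logistic t = (1 + exp t)⁻¹ := by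
  unfold logistic
  field_simp
  ring

theorem one_sub_logistic_pos (t : ℝ) : 0 < 1 - logistic t := by
  rw [one_sub_logistic]; positivity

theorem logistic_mul_one_sub_le (t : ℝ) : logistic t * (1 - logistic t) ≤ exp (-|t|) := by
  have he := exp_pos t
  have h : logistic t * (1 - logistic t) = exp t / (1 + exp t) ^ 2 := by
    rw [one_sub_logistic]; unfold logistic; field_simp
  rw [h, div_le_iff₀ (by positivity)]
  rcases abs_cases t with ⟨h, -⟩ | ⟨h, -⟩ <;> rw [h]
  · rw [exp_neg]
    have : (exp t)⁻¹ * (1 + exp t) ^ 2 = (exp t)⁻¹ + 2 + exp t := by field_simp; ring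
    rw [this]
    have := inv_pos.2 he
    linarith
  · rw [neg_neg]
    nlinarith [mul_pos he he, mul_pos (mul_pos he he) he]

theorem continuous_logistic : Continuous logistic := by
  unfold logistic
  exact continuous_exp.div (by fun_prop) fun t => by positivity

theorem lintegral_exp_neg_mul_norm_lt_top (m : ℕ) {c : ℝ} (hc : 0 < c) :
    ∫⁻ β : Fin m → ℝ, ENNReal.ofReal (exp (-(c * ‖β‖))) < ⊤ := by
  have hint : Integrable fun β : Fin m → ℝ =>
      exp c * (m + 1).factorial / c ^ (m + 1) * (1 + ‖β‖) ^ (-((m + 1 : ℕ) : ℝ)) :=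
    (integrable_one_add_norm (by simp)).const_mul _
  refine lt_of_le_of_lt (lintegral_mono fun β => ENNReal.ofReal_le_ofReal ?_)
    hint.lintegral_lt_top
  have hn : 0 ≤ ‖β‖ := norm_nonneg β
  have h := pow_div_factorial_le_exp (c * (1 + ‖β‖)) (by positivity) (m + 1)
  rw [mul_add, mul_one, exp_add, ← mul_one_add, mul_pow, div_le_iff₀ (by positivity)] at h
  rw [rpow_neg (by positivity), rpow_natCast, exp_neg, ← div_eq_mul_inv, div_div,
    le_div_iff₀ (by positivity), inv_mul_le_iff₀ (exp_pos _)]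
  linarith

theorem exists_mul_norm_le_sum_abs {k m : ℕ} (x : Fin k → Fin m → ℝ)
    (hx : (Matrix.of x).rank = m) :
    ∃ c > 0, ∀ β : Fin m → ℝ, c * ‖β‖ ≤ ∑ j, |∑ i, x j i * β i| := by
  have hker : LinearMap.ker (Matrix.of x).mulVecLin = ⊥ := by
    have h := LinearMap.finrank_range_add_finrank_ker (Matrix.of x).mulVecLin
    rw [← Matrix.rank, hx, Module.finrank_fin_fun] at h
    exact Submodule.finrank_eq_zero.1 (by omega)
  obtain ⟨K, hK, hKa⟩ := LinearMap.exists_antilipschitzWith _ hker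
  have hK' : (0 : ℝ) < K := hK
  refine ⟨(K : ℝ)⁻¹, by positivity, fun β => ?_⟩
  have h1 : ‖β‖ ≤ K * ‖(Matrix.of x).mulVecLin β‖ := by
    simpa using hKa.le_mul_norm_sub β 0
  rw [inv_mul_le_iff₀ hK']
  refine h1.trans (mul_le_mul_of_nonneg_left ?_ hK'.le)
  refine (pi_norm_le_iff_of_nonneg (sum_nonneg fun _ _ => abs_nonneg _)).2 fun j => ?_
  exact single_le_sum (f := fun j => |∑ i, x j i * β i|) (fun _ _ => abs_nonneg _) (mem_univ j)

theorem exists_ne_zero_of_rank_ne {k m : ℕ} (x : Fin k → Fin m → ℝ)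
    (hx : (Matrix.of x).rank ≠ m) :
    ∃ v : Fin m → ℝ, v ≠ 0 ∧ ∀ j, ∑ i, x j i * v i = 0 := by
  by_contra! hcon
  apply hx
  have hker : LinearMap.ker (Matrix.of x).mulVecLin = ⊥ := by
    refine (Submodule.eq_bot_iff _).2 fun v hv => ?_
    by_contra hv0
    obtain ⟨j, hj⟩ := hcon v hv0
    exact hj (congrFun hv j)
  have h := LinearMap.finrank_range_add_finrank_ker (Matrix.of x).mulVecLin
  rw [hker, finrank_bot, Module.finrank_fin_fun, add_zero] at h
  exact h

theorem lintegral_eq_top_of_add_smul_invariant {m : ℕ} {w : (Fin m → ℝ) → ENNReal}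
    (hw : Measurable w) (hpos : ∀ β, 0 < w β) {v : Fin m → ℝ} (hv : v ≠ 0)
    (hinv : ∀ β (t : ℝ), w (β + t • v) = w β) : ∫⁻ β, w β = ⊤ := by
  obtain ⟨i, hi⟩ := Function.ne_iff.1 hv
  let φ : Module.Dual ℝ (Fin m → ℝ) := (v i)⁻¹ • LinearMap.proj i
  have hdet : (LinearMap.transvection φ v).det = 2 := by
    rw [LinearMap.transvection.det]
    have : φ v = 1 := inv_mul_cancel₀ hi
    rw [this]; norm_num
  have hmap := Measure.map_linearMap_addHaar_eq_smul_addHaar (volume : Measure (Fin m → ℝ))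
    (f := LinearMap.transvection φ v) (by rw [hdet]; norm_num)
  have hmeas : Measurable (LinearMap.transvection φ v) :=
    (LinearMap.continuous_of_finiteDimensional _).measurable
  have h := lintegral_map (μ := volume) hw hmeas
  rw [hmap, lintegral_smul_measure, hdet] at h
  simp only [LinearMap.transvection.apply, hinv] at h
  by_contra htop
  have h0 : ∫⁻ β, w β ≠ 0 := by
    intro h0
    rw [lintegral_eq_zero_iff hw] at h0
    obtain ⟨β, hβ⟩ := h0.exists
    exact (hpos β).ne' hβ
  have h2 := congrArg ENNReal.toReal h
  have h3 := ENNReal.toReal_pos h0 htop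
  rw [smul_eq_mul, ENNReal.toReal_mul, ENNReal.toReal_ofReal (abs_nonneg _)] at h2
  norm_num at h2
  linarith

theorem betaFn_ratio_mean_bounds {n y : ℕ} (h : 2 ≤ n ∧ 1 ≤ y ∧ y ≤ n - 1) {r p : ℝ}
    (hr : 0 < r) (hp : 0 < p) (hq : 0 < 1 - p) :
    r ^ 2 / (∏ i ∈ range n, (r + i)) * ((y - 1).factorial * (n - y - 1).factorial) *
        (p * (1 - p)) ≤
      betaFn (y + r * p) ((n - y) + r * (1 - p)) / betaFn (r * p) (r * (1 - p)) ∧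
    betaFn (y + r * p) ((n - y) + r * (1 - p)) / betaFn (r * p) (r * (1 - p)) ≤
      p * (1 - p) := by
  obtain ⟨s, rfl⟩ : ∃ s, y = s + 1 := ⟨y - 1, by omega⟩
  obtain ⟨t, rfl⟩ : ∃ t, n = s + 1 + (t + 1) := ⟨n - s - 2, by omega⟩
  have ha : 0 < r * p := mul_pos hr hp
  have hb : 0 < r * (1 - p) := mul_pos hr hq
  have hab : r * p + r * (1 - p) = r := by ring
  have hcast : ((s + 1 + (t + 1) : ℕ) : ℝ) - ((s + 1 : ℕ) : ℝ) = ((t + 1 : ℕ) : ℝ) := by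
    push_cast; ring
  have h1 := le_betaFn_ratio ha hb s t
  have h2 := betaFn_ratio_le ha hb s t
  rw [hab] at h1 h2
  rw [hcast, show s + 1 - 1 = s by omega, show s + 1 + (t + 1) - (s + 1) - 1 = t by omega]
  refine ⟨le_of_eq_of_le ?_ h1, h2.trans_eq ?_⟩
  · ring
  · field_simp

theorem bbL_le {k m : ℕ} (x : Fin k → Fin m → ℝ) (n y : Fin k → ℕ)
    (hint : ∀ j, 2 ≤ n j ∧ 1 ≤ y j ∧ y j ≤ n j - 1) {r : ℝ} (hr : 0 < r) (β : Fin m → ℝ) :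
    bbL x n y r β ≤
      (∏ j, ((n j).choose (y j) : ℝ)) * ∏ j, (pE x j β * (1 - pE x j β)) := by
  rw [← prod_mul_distrib]
  refine prod_le_prod (fun j _ => ?_) fun j _ => ?_ <;>
    have hp : 0 < pE x j β := logistic_pos _ <;>
    have hq : 0 < 1 - pE x j β := one_sub_logistic_pos _ <;>
    obtain ⟨hl, hu⟩ := betaFn_ratio_mean_bounds (hint j) hr hp hq <;>
    rw [mul_div_assoc]
  · refine mul_nonneg (Nat.cast_nonneg _) (le_trans ?_ hl)
    have : 0 ≤ ∏ i ∈ range (n j), (r + i) := prod_nonneg fun i _ => by positivity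
    positivity
  · exact mul_le_mul_of_nonneg_left hu (Nat.cast_nonneg _)

theorem exists_pos_mul_le_bbL {k m : ℕ} (x : Fin k → Fin m → ℝ) (n y : Fin k → ℕ)
    (hint : ∀ j, 2 ≤ n j ∧ 1 ≤ y j ∧ y j ≤ n j - 1) :
    ∃ c : ℝ → ℝ, Measurable c ∧ (∀ r, 0 < r → 0 < c r) ∧ ∀ r, 0 < r → ∀ β,
      c r * ∏ j, (pE x j β * (1 - pE x j β)) ≤ bbL x n y r β := by
  refine ⟨fun r => ∏ j, (((n j).choose (y j) : ℝ) * (r ^ 2 / (∏ i ∈ range (n j), (r + i)) *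
    ((y j - 1).factorial * (n j - y j - 1).factorial))), ?_, fun r hr => ?_, fun r hr β => ?_⟩
  · fun_prop
  · refine prod_pos fun j _ => ?_
    have hc : 0 < (n j).choose (y j) := Nat.choose_pos (by have := hint j; omega)
    have : 0 < ∏ i ∈ range (n j), (r + i) := prod_pos fun i _ => by positivity
    positivity
  · rw [← prod_mul_distrib]
    refine prod_le_prod (fun j _ => ?_) fun j _ => ?_ <;>
      have hp : 0 < pE x j β := logistic_pos _ <;>
      have hq : 0 < 1 - pE x j β := one_sub_logistic_pos _
    · have : 0 ≤ ∏ i ∈ range (n j), (r + i) := prod_nonneg fun i _ => by positivity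
      positivity
    · rw [mul_div_assoc, mul_assoc]
      exact mul_le_mul_of_nonneg_left (betaFn_ratio_mean_bounds (hint j) hr hp hq).1
        (Nat.cast_nonneg _)

theorem continuous_pE {k m : ℕ} (x : Fin k → Fin m → ℝ) (j : Fin k) : Continuous (pE x j) :=
  continuous_logistic.comp (by fun_prop)

/-- Theorem 1: all groups interior, proper hyper-prior density `f` on `(0,∞)` and flat
improper prior on `β`. The posterior normalizing constant is finite iff `rank(X) = m`. -/
theorem posterior_proper_iff_fullRank_all_interior (k m : ℕ) (x : Fin k → Fin m → ℝ)
    (n y : Fin k → ℕ) (hint : ∀ j, 2 ≤ n j ∧ 1 ≤ y j ∧ y j ≤ n j - 1)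
    (f : ℝ → ℝ) (hfm : Measurable f) (hf0 : ∀ r, 0 ≤ f r)
    (hf1 : ∫⁻ r in Set.Ioi (0:ℝ), ENNReal.ofReal (f r) = 1)
    (hfpos : 0 < volume {r : ℝ | 0 < r ∧ 0 < f r}) :
    (∫⁻ β : Fin m → ℝ, ∫⁻ r in Set.Ioi (0:ℝ),
        ENNReal.ofReal (f r * bbL x n y r β)) < ⊤
      ↔ (Matrix.of x).rank = m := by
  constructor
  · intro hfin
    by_contra hrank
    obtain ⟨v, hv, hxv⟩ := exists_ne_zero_of_rank_ne x hrank
    obtain ⟨c, hcm, hc, hcL⟩ := exists_pos_mul_le_bbL x n y hint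
    set w : (Fin m → ℝ) → ℝ := fun β => ∏ j, (pE x j β * (1 - pE x j β)) with hw
    have hwpos : ∀ β, 0 < w β := fun β =>
      prod_pos fun j _ => mul_pos (logistic_pos _) (one_sub_logistic_pos _)
    have hwm : Measurable fun β => ENNReal.ofReal (w β) :=
      (continuous_finsetProd _ fun j _ => (continuous_pE x j).mul
        (continuous_const.sub (continuous_pE x j))).measurable.ennreal_ofReal
    have hwinv : ∀ β (t : ℝ), w (β + t • v) = w β := by
      intro β t
      have : ∀ j, pE x j (β + t • v) = pE x j β := by
        intro j
        unfold pE
        congr 1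
        simp only [Pi.add_apply, Pi.smul_apply, smul_eq_mul, mul_add, sum_add_distrib,
          mul_left_comm _ t, ← mul_sum, hxv, mul_zero, add_zero]
      simp only [hw, this]
    have htop := lintegral_eq_top_of_add_smul_invariant hwm
      (fun β => ENNReal.ofReal_pos.2 (hwpos β)) hv fun β t => by rw [hwinv]
    have hfc : Measurable fun r => ENNReal.ofReal (f r * c r) := (hfm.mul hcm).ennreal_ofReal
    have hK : 0 < ∫⁻ r in Set.Ioi (0 : ℝ), ENNReal.ofReal (f r * c r) := by
      rw [setLIntegral_pos_iff hfc]
      refine hfpos.trans_le (measure_mono fun r hr => ⟨?_, hr.1⟩)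
      exact (ENNReal.ofReal_pos.2 (mul_pos hr.2 (hc r hr.1))).ne'
    refine (not_lt.2 ?_) hfin
    calc ⊤ = ∫⁻ β, (∫⁻ r in Set.Ioi (0 : ℝ), ENNReal.ofReal (f r * c r)) *
          ENNReal.ofReal (w β) := by
          rw [lintegral_const_mul _ hwm, htop, ENNReal.mul_top hK.ne']
      _ ≤ _ := lintegral_mono fun β => by
          rw [← lintegral_mul_const _ hfc]
          refine setLIntegral_mono' measurableSet_Ioi fun r hr => ?_
          rw [← ENNReal.ofReal_mul (mul_nonneg (hf0 r) (hc r hr).le), mul_assoc]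
          exact ENNReal.ofReal_le_ofReal (mul_le_mul_of_nonneg_left (hcL r hr β) (hf0 r))
  · intro hrank
    obtain ⟨c, hc, hcx⟩ := exists_mul_norm_le_sum_abs x hrank
    set C : ℝ := ∏ j, ((n j).choose (y j) : ℝ) with hC
    have hC0 : 0 ≤ C := prod_nonneg fun j _ => Nat.cast_nonneg _
    have hL : ∀ r, 0 < r → ∀ β, bbL x n y r β ≤ C * exp (-(c * ‖β‖)) := by
      intro r hr β
      refine (bbL_le x n y hint hr β).trans (mul_le_mul_of_nonneg_left ?_ hC0)
      calc ∏ j, (pE x j β * (1 - pE x j β)) ≤ ∏ j, exp (-|∑ i, x j i * β i|) :=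
            prod_le_prod (fun j _ => (mul_pos (logistic_pos _) (one_sub_logistic_pos _)).le)
              fun j _ => logistic_mul_one_sub_le _
        _ = exp (-∑ j, |∑ i, x j i * β i|) := by rw [← exp_sum, sum_neg_distrib]
        _ ≤ exp (-(c * ‖β‖)) := exp_le_exp.2 (neg_le_neg (hcx β))
    calc _ ≤ ∫⁻ β : Fin m → ℝ, ENNReal.ofReal C * ENNReal.ofReal (exp (-(c * ‖β‖))) := by
          refine lintegral_mono fun β => ?_
          rw [← ENNReal.ofReal_mul hC0]
          calc _ ≤ ∫⁻ r in Set.Ioi (0 : ℝ),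
                ENNReal.ofReal (f r) * ENNReal.ofReal (C * exp (-(c * ‖β‖))) := by
                refine setLIntegral_mono' measurableSet_Ioi fun r hr => ?_
                rw [← ENNReal.ofReal_mul (hf0 r)]
                exact ENNReal.ofReal_le_ofReal
                  (mul_le_mul_of_nonneg_left (hL r hr β) (hf0 r))
            _ = _ := by rw [lintegral_mul_const _ hfm.ennreal_ofReal, hf1, one_mul]
      _ = ENNReal.ofReal C * ∫⁻ β : Fin m → ℝ, ENNReal.ofReal (exp (-(c * ‖β‖))) :=
          lintegral_const_mul _ (by fun_prop)
      _ < ⊤ := ENNReal.mul_lt_top ENNReal.ofReal_lt_top (lintegral_exp_neg_mul_norm_lt_top m hc)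
end

section
/- Suppose all k groups are interior (n_j ≥ 2 and 1 ≤ y_j ≤ n_j − 1 for all j), let u > 0, let g be a probability density on ℝ^m that is strictly positive on a set of positive measure, and suppose k ≤ u. Then ∫_{ℝ^m} ∫_0^∞ r^{−(u+1)} · g(β) · L(r, β) dr dβ = ∞, i.e., the posterior is improper. -/
open MeasureTheory Real Filter Finset

/-- The logistic function takes values in `(0, 1)`. -/
theorem logistic_mem_Ioo (t : ℝ) : logistic t ∈ Set.Ioo (0:ℝ) 1 := by
  have h := Real.exp_pos t
  refine ⟨by unfold logistic; positivity, ?_⟩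
  rw [logistic, div_lt_one (by positivity)]
  linarith

/-- A ratio of Beta functions whose denominator has parameters `r * p`, `r * (1 - p)` vanishes at
most linearly as `r → 0`. -/
theorem exists_mul_le_betaFn_div_betaFn {p s t : ℝ} (hp : p ∈ Set.Ioo (0:ℝ) 1) (hs : 0 < s)
    (ht : 0 < t) :
    ∃ c > 0, ∀ r ∈ Set.Ioc (0:ℝ) 1,
      c * r ≤ betaFn (s + r * p) (t + r * (1 - p)) / betaFn (r * p) (r * (1 - p)) := by
  obtain ⟨hp0, hp1⟩ := hp
  have hq0 : 0 < 1 - p := sub_pos.2 hp1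
  let F : ℝ → ℝ := fun r => p * (1 - p) * (Gamma (s + r * p) * Gamma (t + r * (1 - p)) *
    Gamma (r + 1) / (Gamma (s + t + r) * Gamma (r * p + 1) * Gamma (r * (1 - p) + 1)))
  have hG : ∀ f : ℝ → ℝ, Continuous f → (∀ r ∈ Set.Icc (0:ℝ) 1, 0 < f r) →
      ContinuousOn (fun r => Gamma (f r)) (Set.Icc 0 1) := fun f hf h r hr =>
    ((Real.differentiableAt_Gamma fun N => ((neg_nonpos.2 N.cast_nonneg).trans_lt (h r hr)).ne').continuousAt.comp
      hf.continuousAt).continuousWithinAt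
  have hpos : ∀ r ∈ Set.Icc (0:ℝ) 1, 0 < s + r * p ∧ 0 < t + r * (1 - p) ∧ 0 < r + 1 ∧
      0 < s + t + r ∧ 0 < r * p + 1 ∧ 0 < r * (1 - p) + 1 := fun r hr => by
    have := hr.1
    refine ⟨?_, ?_, ?_, ?_, ?_, ?_⟩ <;> positivity
  have hFpos : ∀ r ∈ Set.Icc (0:ℝ) 1, 0 < F r := fun r hr => by
    obtain ⟨h1, h2, h3, h4, h5, h6⟩ := hpos r hr
    have := Gamma_pos_of_pos h1
    have := Gamma_pos_of_pos h2
    have := Gamma_pos_of_pos h3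
    have := Gamma_pos_of_pos h4
    have := Gamma_pos_of_pos h5
    have := Gamma_pos_of_pos h6
    positivity
  have hFc : ContinuousOn F (Set.Icc 0 1) := by
    refine continuousOn_const.mul (ContinuousOn.div
      (((hG _ (by fun_prop) fun r hr => (hpos r hr).1).mul
        (hG _ (by fun_prop) fun r hr => (hpos r hr).2.1)).mul
        (hG _ (by fun_prop) fun r hr => (hpos r hr).2.2.1))
      (((hG _ (by fun_prop) fun r hr => (hpos r hr).2.2.2.1).mul
        (hG _ (by fun_prop) fun r hr => (hpos r hr).2.2.2.2.1)).mul
        (hG _ (by fun_prop) fun r hr => (hpos r hr).2.2.2.2.2)) fun r hr => ?_)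
    obtain ⟨-, -, -, h4, h5, h6⟩ := hpos r hr
    exact mul_ne_zero (mul_ne_zero (Gamma_pos_of_pos h4).ne' (Gamma_pos_of_pos h5).ne')
      (Gamma_pos_of_pos h6).ne'
  obtain ⟨r₀, hr₀, hmin⟩ := isCompact_Icc.exists_isMinOn (Set.nonempty_Icc.2 zero_le_one) hFc
  refine ⟨F r₀, hFpos r₀ hr₀, fun r hr => ?_⟩
  have hr' : r ∈ Set.Icc (0:ℝ) 1 := Set.Ioc_subset_Icc_self hr
  have hr0 : 0 < r := hr.1
  have hrp : 0 < r * p := by positivity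
  have hrq : 0 < r * (1 - p) := by positivity
  refine (mul_le_mul_of_nonneg_right (hmin hr') hr0.le).trans_eq ?_
  obtain ⟨h1, h2, -, h4, -, -⟩ := hpos r hr'
  rw [betaFn_eq_beta h1 h2, betaFn_eq_beta hrp hrq, ProbabilityTheory.beta,
    ProbabilityTheory.beta]
  have e1 : s + r * p + (t + r * (1 - p)) = s + t + r := by ring
  have e2 : r * p + r * (1 - p) = r := by ring
  rw [e1, e2]
  simp only [F]
  rw [Gamma_add_one hr0.ne', Gamma_add_one hrp.ne', Gamma_add_one hrq.ne']
  have := Gamma_pos_of_pos hr0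
  have := Gamma_pos_of_pos hrp
  have := Gamma_pos_of_pos hrq
  have := Gamma_pos_of_pos h4
  field_simp

/-- If all groups are interior, the Beta-Binomial likelihood is bounded below by a positive multiple
of `r ^ k` for `r ∈ (0, 1]`. -/
theorem exists_mul_pow_le_bbL {k m : ℕ} (x : Fin k → Fin m → ℝ) {n y : Fin k → ℕ}
    (hint : ∀ j, 1 ≤ y j ∧ y j < n j) (β : Fin m → ℝ) :
    ∃ c > 0, ∀ r ∈ Set.Ioc (0:ℝ) 1, c * r ^ k ≤ bbL x n y r β := by
  have key : ∀ j, ∃ c > 0, ∀ r ∈ Set.Ioc (0:ℝ) 1, c * r ≤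
      ((n j).choose (y j) : ℝ) *
        betaFn ((y j : ℝ) + r * pE x j β) (((n j : ℝ) - (y j : ℝ)) + r * (1 - pE x j β)) /
        betaFn (r * pE x j β) (r * (1 - pE x j β)) := fun j => by
    obtain ⟨hy, hyn⟩ := hint j
    obtain ⟨c, hc, h⟩ := exists_mul_le_betaFn_div_betaFn (p := pE x j β) (s := (y j : ℝ))
      (t := (n j : ℝ) - (y j : ℝ)) (logistic_mem_Ioo _) (by exact_mod_cast hy)
      (sub_pos.2 (by exact_mod_cast hyn))
    have hC : (0:ℝ) < (n j).choose (y j) := by exact_mod_cast Nat.choose_pos hyn.le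
    refine ⟨(n j).choose (y j) * c, by positivity, fun r hr => ?_⟩
    rw [mul_assoc, mul_div_assoc]
    exact mul_le_mul_of_nonneg_left (h r hr) hC.le
  choose c hc h using key
  refine ⟨∏ j, c j, Finset.prod_pos fun j _ => hc j, fun r hr => ?_⟩
  calc (∏ j, c j) * r ^ k = ∏ j, c j * r := by simp [Finset.prod_mul_distrib]
    _ ≤ _ := Finset.prod_le_prod (fun j _ => mul_nonneg (hc j).le hr.1.le) fun j _ => h j r hr

/-- `1 / r` has infinite integral near `0`. -/
theorem lintegral_inv_Ioc_zero_one :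
    ∫⁻ r in Set.Ioc (0:ℝ) 1, ENNReal.ofReal r⁻¹ = ⊤ := by
  by_contra hne
  have hint : IntegrableOn (fun r : ℝ => r⁻¹) (Set.Ioc 0 1) := by
    refine ⟨measurable_inv.aestronglyMeasurable, ?_⟩
    rw [hasFiniteIntegral_iff_ofReal]
    · exact lt_top_iff_ne_top.2 hne
    · filter_upwards [ae_restrict_mem measurableSet_Ioc] with r hr
      exact inv_nonneg.2 hr.1.le
  rw [← intervalIntegrable_iff_integrableOn_Ioc_of_le zero_le_one, intervalIntegrable_inv_iff]
    at hint
  simp at hint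

/-- Theorem 2 (necessity): all groups interior, improper hyper-prior `dr/r^{u+1}` on `r`,
proper hyper-prior density `g` on `β`, and `k ≤ u`. Then the posterior is improper. -/
theorem posterior_improper_improper_r_proper_beta (k m : ℕ) (x : Fin k → Fin m → ℝ)
    (n y : Fin k → ℕ) (hint : ∀ j, 2 ≤ n j ∧ 1 ≤ y j ∧ y j ≤ n j - 1)
    (u : ℝ) (hu : 0 < u) (hk : (k : ℝ) ≤ u)
    (g : (Fin m → ℝ) → ℝ) (hgm : Measurable g) (hg0 : ∀ β, 0 ≤ g β)
    (hg1 : ∫⁻ β : Fin m → ℝ, ENNReal.ofReal (g β) = 1)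
    (hgpos : 0 < volume {β : Fin m → ℝ | 0 < g β}) :
    (∫⁻ β : Fin m → ℝ, ∫⁻ r in Set.Ioi (0:ℝ),
        ENNReal.ofReal (r ^ (-(u + 1)) * g β * bbL x n y r β)) = ⊤ := by
  have inner : ∀ β ∈ {β : Fin m → ℝ | 0 < g β}, ∫⁻ r in Set.Ioi (0:ℝ),
      ENNReal.ofReal (r ^ (-(u + 1)) * g β * bbL x n y r β) = ⊤ := fun β hβ => by
    have hgβ : 0 < g β := hβ
    obtain ⟨c, hc, h⟩ := exists_mul_pow_le_bbL x (n := n)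
      (fun j => ⟨(hint j).2.1, by have := hint j; omega⟩) β
    refine top_unique ?_
    calc (⊤ : ENNReal) = ENNReal.ofReal (g β * c) *
          ∫⁻ r in Set.Ioc (0:ℝ) 1, ENNReal.ofReal r⁻¹ := by
          rw [lintegral_inv_Ioc_zero_one, ENNReal.mul_top]
          exact (ENNReal.ofReal_pos.2 (by positivity)).ne'
      _ = ∫⁻ r in Set.Ioc (0:ℝ) 1, ENNReal.ofReal (g β * c) * ENNReal.ofReal r⁻¹ :=
          (lintegral_const_mul' _ _ ENNReal.ofReal_ne_top).symm
      _ ≤ ∫⁻ r in Set.Ioc (0:ℝ) 1,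
            ENNReal.ofReal (r ^ (-(u + 1)) * g β * bbL x n y r β) := by
          refine setLIntegral_mono' measurableSet_Ioc fun r hr => ?_
          have hr0 : 0 < r := hr.1
          rw [← ENNReal.ofReal_mul (by positivity)]
          refine ENNReal.ofReal_le_ofReal ?_
          have hpow : r⁻¹ ≤ r ^ (-(u + 1)) * r ^ k := by
            rw [← rpow_natCast, ← rpow_add hr0, ← rpow_neg_one]
            exact rpow_le_rpow_of_exponent_ge hr0 hr.2 (by linarith)
          calc g β * c * r⁻¹ ≤ g β * c * (r ^ (-(u + 1)) * r ^ k) := by gcongr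
            _ = r ^ (-(u + 1)) * g β * (c * r ^ k) := by ring
            _ ≤ _ := mul_le_mul_of_nonneg_left (h r hr) (by positivity)
      _ ≤ _ := lintegral_mono_set Set.Ioc_subset_Ioi_self
  have hS : MeasurableSet {β : Fin m → ℝ | 0 < g β} := measurableSet_lt measurable_const hgm
  refine top_unique ?_
  calc (⊤ : ENNReal) = ∫⁻ _ in {β : Fin m → ℝ | 0 < g β}, ⊤ := by
        rw [setLIntegral_const, ENNReal.top_mul hgpos.ne']
    _ = ∫⁻ β in {β : Fin m → ℝ | 0 < g β}, ∫⁻ r in Set.Ioi (0:ℝ),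
          ENNReal.ofReal (r ^ (-(u + 1)) * g β * bbL x n y r β) :=
        setLIntegral_congr_fun hS fun β hβ => (inner β hβ).symm
    _ ≤ _ := setLIntegral_le_lintegral _ _
end

section
/- Suppose all k groups are extreme, i.e., for each j, y_j = 0 or y_j = n_j (with n_j ≥ 1). Then there exist constants c3, c4 > 0 depending only on the data such that for all r > 0 and β ∈ ℝ^m: c3 · ∏_{j=1}^k (p_j^E(β))^{n_j·1{y_j = n_j}} (q_j^E(β))^{n_j·1{y_j = 0}} ≤ L(r, β) ≤ c4 · ∏_{j=1}^k (p_j^E(β))^{1{y_j = n_j}} (q_j^E(β))^{1{y_j = 0}}. In particular, both bounds are free of r. -/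
open MeasureTheory Real Filter Finset

/-- Shifting the first argument of the Beta function by a positive integer multiplies it by a
factor between a power of the mean `a / (a + b)` and the mean itself. -/
theorem betaFn_natCast_add_bounds {a b : ℝ} (ha : 0 < a) (hb : 0 < b) {n : ℕ} (hn : 1 ≤ n) :
    (a / (a + b)) ^ n ≤ betaFn (n + a) b / betaFn a b ∧
      betaFn (n + a) b / betaFn a b ≤ a / (a + b) := by
  have hB := betaFn_pos ha hb
  induction n, hn using Nat.le_induction with
  | base =>
    rw [Nat.cast_one, add_comm 1 a, betaFn_add_one_left ha hb, mul_div_cancel_right₀ _ hB.ne',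
      pow_one]
    exact ⟨le_rfl, le_rfl⟩
  | succ n hn ih =>
    have hna : 0 < (n : ℝ) + a := by positivity
    have hpos : 0 < betaFn (n + a) b / betaFn a b := div_pos (betaFn_pos hna hb) hB
    rw [Nat.cast_succ, add_right_comm, betaFn_add_one_left hna hb, mul_div_assoc, pow_succ']
    constructor
    · refine mul_le_mul ?_ ih.1 (by positivity) (by positivity)
      rw [div_le_div_iff₀ (by positivity) (by positivity)]
      nlinarith [mul_nonneg (Nat.cast_nonneg n : (0 : ℝ) ≤ n) hb.le]
    · refine (mul_le_of_le_one_left hpos.le ?_).trans ih.2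
      exact (div_le_one (by positivity)).2 (by linarith)

theorem pE_pos {k m : ℕ} (x : Fin k → Fin m → ℝ) (j : Fin k) (β : Fin m → ℝ) :
    0 < pE x j β := by
  unfold pE logistic
  positivity

theorem pE_lt_one {k m : ℕ} (x : Fin k → Fin m → ℝ) (j : Fin k) (β : Fin m → ℝ) :
    pE x j β < 1 := by
  unfold pE logistic
  rw [div_lt_one (by positivity)]
  linarith

/-- The likelihood factor of one extreme group lies between the product of the success
probabilities raised to the number of trials and the same product with exponent one. -/
theorem extreme_factor_bounds {r p : ℝ} (hr : 0 < r) (hp : 0 < p) (hp1 : p < 1) {n y : ℕ}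
    (hn : 1 ≤ n) (hy : y = 0 ∨ y = n) :
    p ^ (n * if y = n then 1 else 0) * (1 - p) ^ (n * if y = 0 then 1 else 0) ≤
        (n.choose y : ℝ) * betaFn (y + r * p) ((n - y : ℝ) + r * (1 - p)) /
          betaFn (r * p) (r * (1 - p)) ∧
      (n.choose y : ℝ) * betaFn (y + r * p) ((n - y : ℝ) + r * (1 - p)) /
          betaFn (r * p) (r * (1 - p)) ≤
        p ^ (if y = n then 1 else 0) * (1 - p) ^ (if y = 0 then 1 else 0) := by
  have ha : 0 < r * p := mul_pos hr hp
  have hb : 0 < r * (1 - p) := mul_pos hr (sub_pos.2 hp1)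
  have hn0 : n ≠ 0 := by omega
  rcases hy with rfl | rfl
  · have h := betaFn_natCast_add_bounds hb ha hn
    have hq : r * (1 - p) / (r * (1 - p) + r * p) = 1 - p := by
      field_simp
      ring
    rw [hq, betaFn_comm (by positivity) ha, betaFn_comm hb ha] at h
    simpa [hn0.symm] using h
  · have h := betaFn_natCast_add_bounds ha hb hn
    have hq : r * p / (r * p + r * (1 - p)) = p := by
      field_simp
      ring
    rw [hq] at h
    simpa [hn0] using h

/-- Lemma 3: when all groups are extreme, the likelihood is bounded above and below by
functions of `β` alone:
`c3 ∏ (pⱼᴱ)^{nⱼ 1{yⱼ=nⱼ}} (qⱼᴱ)^{nⱼ 1{yⱼ=0}} ≤ L(r,β) ≤ c4 ∏ (pⱼᴱ)^{1{yⱼ=nⱼ}} (qⱼᴱ)^{1{yⱼ=0}}`. -/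
theorem likelihood_bounds_all_extreme (k m : ℕ) (x : Fin k → Fin m → ℝ) (n y : Fin k → ℕ)
    (hn : ∀ j, 1 ≤ n j) (hext : ∀ j, y j = 0 ∨ y j = n j) :
    ∃ c3 c4 : ℝ, 0 < c3 ∧ 0 < c4 ∧
      ∀ r : ℝ, 0 < r → ∀ β : Fin m → ℝ,
        c3 * (∏ j : Fin k, pE x j β ^ (n j * if y j = n j then 1 else 0) *
              (1 - pE x j β) ^ (n j * if y j = 0 then 1 else 0))
            ≤ bbL x n y r β ∧
          bbL x n y r β
            ≤ c4 * (∏ j : Fin k, pE x j β ^ (if y j = n j then 1 else 0) *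
                (1 - pE x j β) ^ (if y j = 0 then 1 else 0)) := by
  have h (r : ℝ) (hr : 0 < r) (β : Fin m → ℝ) (j : Fin k) :=
    extreme_factor_bounds hr (pE_pos x j β) (pE_lt_one x j β) (hn j) (hext j)
  refine ⟨1, 1, one_pos, one_pos, fun r hr β => ?_⟩
  have hnonneg (j : Fin k) (s t : ℕ) : 0 ≤ pE x j β ^ s * (1 - pE x j β) ^ t :=
    mul_nonneg (pow_nonneg (pE_pos x j β).le s)
      (pow_nonneg (sub_nonneg.2 (pE_lt_one x j β).le) t)
  rw [one_mul, one_mul, bbL]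
  exact ⟨Finset.prod_le_prod (fun j _ => hnonneg j _ _) fun j _ => (h r hr β j).1,
    Finset.prod_le_prod (fun j _ => (hnonneg j _ _).trans (h r hr β j).1)
      fun j _ => (h r hr β j).2⟩
end
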